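/- The graph F(8,13,10), defined as the simple graph on vertex set {1,...,8} with edge set {{1,2},{2,4},{3,4},{2,3},{1,3},{3,5},{5,6},{4,6},{5,7},{7,8},{6,8},{6,7},{1,8}}, is forbidden: there is no injective map φ : {1,...,8} → ℝ² with dist(φ(i), φ(j)) = 1 for every edge {i,j}. -/

import Mathlib

theorem orth_aux (v1 v2 s1 s2 f1 f2 : ℝ) (h1 : v1*s1+v2*s2=0) (h2 : v1*f1+v2*f2=0)
    (h3 : s1*f1+s2*f2=0) (hs : s1^2+s2^2 ≠ 0) (hf : f1^2+f2^2 ≠ 0) : v1 = 0 ∧ v2 = 0 := by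
  have hd : s1*f2-s2*f1 ≠ 0 := by
    intro h
    have : (s1^2+s2^2)*(f1^2+f2^2) = 0 := by
      linear_combination (s1*f1+s2*f2)*h3 + (s1*f2-s2*f1)*h
    exact (mul_ne_zero hs hf) this
  constructor
  · apply (mul_eq_zero.mp (_ : (s1*f2-s2*f1)*v1 = 0)).resolve_left hd
    linear_combination f2*h1 - s2*h2
  · apply (mul_eq_zero.mp (_ : (s1*f2-s2*f1)*v2 = 0)).resolve_left hd
    linear_combination s1*h2 - f1*h1

theorem sq_aux (a b c d : ℝ) (h : ¬ (a = c ∧ b = d)) : (a-c)^2+(b-d)^2 ≠ 0 := by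
  intro h0
  apply h
  constructor <;> nlinarith [sq_nonneg (a-c), sq_nonneg (b-d)]

theorem rhombus_aux (p1 p2 q1 q2 x1 x2 y1 y2 : ℝ)
    (hpq : ¬ (p1 = q1 ∧ p2 = q2)) (hxy : ¬ (x1 = y1 ∧ x2 = y2))
    (h1 : (p1-x1)^2+(p2-x2)^2=1) (h2 : (p1-y1)^2+(p2-y2)^2=1)
    (h3 : (q1-x1)^2+(q2-x2)^2=1) (h4 : (q1-y1)^2+(q2-y2)^2=1) :
    p1+q1=x1+y1 ∧ p2+q2=x2+y2 := by
  have := orth_aux (p1+q1-x1-y1) (p2+q2-x2-y2) (p1-q1) (p2-q2) (x1-y1) (x2-y2)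
    (by linear_combination (h1+h2-h3-h4)/2) (by linear_combination (h2+h4-h1-h3)/2)
    (by linear_combination (h2-h4-h1+h3)/2) (sq_aux _ _ _ _ hpq) (sq_aux _ _ _ _ hxy)
  constructor <;> linarith [this.1, this.2]

theorem dist_aux (p q : EuclideanSpace ℝ (Fin 2)) (h : dist p q = 1) :
    (p 0 - q 0)^2 + (p 1 - q 1)^2 = 1 := by
  rw [EuclideanSpace.dist_eq, Real.sqrt_eq_one, Fin.sum_univ_two, Real.dist_eq, Real.dist_eq,
    sq_abs, sq_abs] at h
  exact h

set_option maxHeartbeats 1000000 in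
theorem F_8_13_10_forbidden :
    ¬ ∃ φ : ℕ → EuclideanSpace ℝ (Fin 2),
      Set.InjOn φ (Set.Icc 1 8) ∧
      dist (φ 1) (φ 2) = 1 ∧
      dist (φ 2) (φ 4) = 1 ∧
      dist (φ 3) (φ 4) = 1 ∧
      dist (φ 2) (φ 3) = 1 ∧
      dist (φ 1) (φ 3) = 1 ∧
      dist (φ 3) (φ 5) = 1 ∧
      dist (φ 5) (φ 6) = 1 ∧
      dist (φ 4) (φ 6) = 1 ∧
      dist (φ 5) (φ 7) = 1 ∧
      dist (φ 7) (φ 8) = 1 ∧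
      dist (φ 6) (φ 8) = 1 ∧
      dist (φ 6) (φ 7) = 1 ∧
      dist (φ 1) (φ 8) = 1 := by
  rintro ⟨φ, hinj, h12, h24, h34, h23, h13, h35, h56, h46, h57, h78, h68, h67, h18⟩
  have ne : ∀ i j : ℕ, i ∈ Set.Icc 1 8 → j ∈ Set.Icc 1 8 → i ≠ j →
      ¬ (φ i 0 = φ j 0 ∧ φ i 1 = φ j 1) := by
    intro i j hi hj hij h
    apply hij
    apply hinj hi hj
    ext k
    fin_cases k
    · exact h.1
    · exact h.2
  have n14 := ne 1 4 (by simp) (by simp) (by simp)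
  have n23 := ne 2 3 (by simp) (by simp) (by simp)
  have n36 := ne 3 6 (by simp) (by simp) (by simp)
  have n45 := ne 4 5 (by simp) (by simp) (by simp)
  have n58 := ne 5 8 (by simp) (by simp) (by simp)
  have n67 := ne 6 7 (by simp) (by simp) (by simp)
  have n34 := ne 3 4 (by simp) (by simp) (by simp)
  clear ne hinj
  apply dist_aux at h12
  apply dist_aux at h24
  apply dist_aux at h34
  apply dist_aux at h23
  apply dist_aux at h13
  apply dist_aux at h35
  apply dist_aux at h56
  apply dist_aux at h46
  apply dist_aux at h57
  apply dist_aux at h78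
  apply dist_aux at h68
  apply dist_aux at h67
  apply dist_aux at h18
  generalize φ 1 0 = x1 at *
  generalize φ 1 1 = y1 at *
  generalize φ 2 0 = x2 at *
  generalize φ 2 1 = y2 at *
  generalize φ 3 0 = x3 at *
  generalize φ 3 1 = y3 at *
  generalize φ 4 0 = x4 at *
  generalize φ 4 1 = y4 at *
  generalize φ 5 0 = x5 at *
  generalize φ 5 1 = y5 at *
  generalize φ 6 0 = x6 at *
  generalize φ 6 1 = y6 at *
  generalize φ 7 0 = x7 at *
  generalize φ 7 1 = y7 at *
  generalize φ 8 0 = x8 at *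
  generalize φ 8 1 = y8 at *
  obtain ⟨a1, a2⟩ := rhombus_aux x1 y1 x4 y4 x2 y2 x3 y3 n14 n23 h12 h13
    (by linarith) (by linarith)
  obtain ⟨b1, b2⟩ := rhombus_aux x3 y3 x6 y6 x4 y4 x5 y5 n36 n45 h34 h35
    (by linarith) (by linarith)
  obtain ⟨c1, c2⟩ := rhombus_aux x5 y5 x8 y8 x6 y6 x7 y7 n58 n67 h56 h57
    (by linarith) (by linarith)
  -- u = p2 - p3, w = p7 - p5, a = p4 - p3, b = p5 - p3
  obtain ⟨a, ha⟩ : ∃ a, a = x4 - x3 := ⟨_, rfl⟩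
  obtain ⟨a', ha'⟩ : ∃ a, a = y4 - y3 := ⟨_, rfl⟩
  obtain ⟨b, hb⟩ : ∃ a, a = x5 - x3 := ⟨_, rfl⟩
  obtain ⟨b', hb'⟩ : ∃ a, a = y5 - y3 := ⟨_, rfl⟩
  obtain ⟨u, hu⟩ : ∃ a, a = x2 - x3 := ⟨_, rfl⟩
  obtain ⟨u', hu'⟩ : ∃ a, a = y2 - y3 := ⟨_, rfl⟩
  obtain ⟨w, hw⟩ : ∃ a, a = x7 - x5 := ⟨_, rfl⟩
  obtain ⟨w', hw'⟩ : ∃ a, a = y7 - y5 := ⟨_, rfl⟩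
  obtain rfl : x4 = x3 + a := by linarith
  obtain rfl : y4 = y3 + a' := by linarith
  obtain rfl : x5 = x3 + b := by linarith
  obtain rfl : y5 = y3 + b' := by linarith
  obtain rfl : x2 = x3 + u := by linarith
  obtain rfl : y2 = y3 + u' := by linarith
  obtain rfl : x7 = x3 + b + w := by linarith
  obtain rfl : y7 = y3 + b' + w' := by linarith
  obtain rfl : x6 = x3 + a + b := by linarith
  obtain rfl : y6 = y3 + a' + b' := by linarith
  obtain rfl : x8 = x3 + a + b + w := by linarith
  obtain rfl : y8 = y3 + a' + b' + w' := by linarith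
  obtain rfl : x1 = x3 + u - a := by linarith
  obtain rfl : y1 = y3 + u' - a' := by linarith
  have A : a^2+a'^2 = 1 := by linear_combination h34
  have B : b^2+b'^2 = 1 := by linear_combination h35
  have W : w^2+w'^2 = 1 := by linear_combination h57
  have AW : a*w+a'*w' = 1/2 := by linear_combination (A+W-h67)/2
  by_cases huw : u = w ∧ u' = w'
  · obtain ⟨rfl, rfl⟩ := huw
    have AB : a*b+a'*b' = -1 := by linear_combination (h18-B-4*A)/4
    have S : (a+b)^2+(a'+b')^2 = 0 := by linear_combination A+B+2*AB
    exact sq_aux _ _ _ _ n36 (by linear_combination S)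
  · obtain ⟨d1, d2⟩ := rhombus_aux u u' w w' 0 0 a a' huw
      (by rintro ⟨h, h'⟩; apply n34; constructor <;> linarith)
      (by linear_combination h23) (by linear_combination h24)
      (by linear_combination W) (by linear_combination h67)
    obtain rfl : u = a - w := by linarith
    obtain rfl : u' = a' - w' := by linarith
    have E : b*(a+2*w)+b'*(a'+2*w') = -7/2 := by
      linear_combination (h18-B-A-4*W-4*AW)/2
    have F : (a+2*w)^2+(a'+2*w')^2 = 7 := by linear_combination A+4*W+4*AW
    have G : (3*b+(a+2*w))^2 + (3*b'+(a'+2*w'))^2 = -5 := by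
      linear_combination 9*B+F+6*E
    linarith only [G, sq_nonneg (3*b+(a+2*w)), sq_nonneg (3*b'+(a'+2*w'))]
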